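/- Let f be an entire function of finite order ρ(f) and let ε > 0. Suppose that the set {z ∈ Δ : |z f'(z)/f(z)| < |z|^{ρ(f)/2+ε} or |f(z)| < exp(|z|^ε)} has finite logarithmic area. Then logarea(Δ \ A(f)) < ∞; in particular, area A(f) > 0. If, in addition, the Fatou set F(f) has no multiply connected component, then logarea(Δ \ (A(f) ∩ J(f))) < ∞, and thus area(A(f) ∩ J(f)) > 0. -/

import Mathlib

open MeasureTheory Filter Metric Set Topology ENNReal

/-- Logarithmic area of a subset of the plane. -/
noncomputable def logArea (A : Set ℂ) : ℝ≥0∞ :=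
  ∫⁻ z in A, ENNReal.ofReal ((‖z‖ ^ 2)⁻¹)

/-- The set Δ = {z : |z| ≥ 1}. -/
def Delta : Set ℂ := {z : ℂ | 1 ≤ ‖z‖}

/-- Chordal (spherical) distance on the Riemann sphere ℂ ∪ {∞}, with ∞ encoded as `none`. -/
noncomputable def chordalDist : Option ℂ → Option ℂ → ℝ
  | none, none => 0
  | none, some w => 2 / Real.sqrt (1 + ‖w‖ ^ 2)
  | some z, none => 2 / Real.sqrt (1 + ‖z‖ ^ 2)
  | some z, some w =>
      2 * ‖z - w‖ / (Real.sqrt (1 + ‖z‖ ^ 2) * Real.sqrt (1 + ‖w‖ ^ 2))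

/-- Locally uniform convergence on `U` of a sequence of ℂ-valued functions towards a
function with values in the Riemann sphere, with respect to the spherical metric. -/
def SphLocUnifConvOn (F : ℕ → ℂ → ℂ) (g : ℂ → Option ℂ) (U : Set ℂ) : Prop :=
  ∀ K : Set ℂ, K ⊆ U → IsCompact K → ∀ ε : ℝ, 0 < ε →
    ∀ᶠ n in atTop, ∀ z ∈ K, chordalDist (some (F n z)) (g z) < ε

/-- The Fatou set: points having a neighborhood on which every sequence of iterates has a
subsequence converging locally uniformly with respect to the spherical metric. -/
def fatouSet (f : ℂ → ℂ) : Set ℂ :=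
  {z | ∃ U ∈ 𝓝 z, ∀ φ : ℕ → ℕ, StrictMono φ →
    ∃ ψ : ℕ → ℕ, StrictMono ψ ∧ ∃ g : ℂ → Option ℂ,
      SphLocUnifConvOn (fun n => f^[φ (ψ n)]) g U}

/-- The Julia set. -/
def juliaSet (f : ℂ → ℂ) : Set ℂ := (fatouSet f)ᶜ

/-- The escaping set. -/
def escapingSet (f : ℂ → ℂ) : Set ℂ :=
  {z | Tendsto (fun n => ‖f^[n] z‖) atTop atTop}

/-- The Fatou set has no multiply connected component. -/
def NoMultiplyConnectedFatouComponent (f : ℂ → ℂ) : Prop :=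
  ∀ z ∈ fatouSet f, SimplyConnectedSpace (connectedComponentIn (fatouSet f) z)

/-- Maximum modulus M(r,f). -/
noncomputable def maxMod (f : ℂ → ℂ) (r : ℝ) : ℝ :=
  sSup ((fun z => ‖f z‖) '' {z : ℂ | ‖z‖ = r})

/-- The order ρ(f) of an entire function, as an extended real number. -/
noncomputable def entireOrder (f : ℂ → ℂ) : EReal :=
  limsup (fun r : ℝ => ((Real.log (Real.log (maxMod f r)) / Real.log r : ℝ) : EReal)) atTop

/-- The fast escaping set A(f). -/
def fastEscapingSet (f : ℂ → ℂ) : Set ℂ :=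
  {z | ∃ R : ℝ, 0 < R ∧ (∀ r : ℝ, R ≤ r → r < maxMod f r) ∧
    ∃ L : ℕ, ∀ n : ℕ, L < n → (maxMod f)^[n - L] R ≤ ‖f^[n] z‖}

/-- `f` is a transcendental entire function. -/
def TranscendentalEntire (f : ℂ → ℂ) : Prop :=
  Differentiable ℂ f ∧ ¬ ∃ p : Polynomial ℂ, ∀ z, f z = p.eval z

/-- Order of vanishing of `g` at `z` (the least `k` with nonzero `k`-th derivative). -/
noncomputable def vanishingOrder (g : ℂ → ℂ) (z : ℂ) : ℕ :=
  sInf {k : ℕ | iteratedDeriv k g z ≠ 0}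

/-- n(r,a): the number of solutions of f(z) = a with |z| ≤ r, counted with multiplicity. -/
noncomputable def nCount (f : ℂ → ℂ) (a : ℂ) (r : ℝ) : ℕ :=
  ∑ᶠ z ∈ {z : ℂ | ‖z‖ ≤ r ∧ f z = a}, vanishingOrder (fun w => f w - a) z

/-- n(r) = max over a of n(r,a). -/
noncomputable def nMax (f : ℂ → ℂ) (r : ℝ) : ℕ := ⨆ a : ℂ, nCount f a r

/-- Critical values of `f`. -/
def criticalValues (f : ℂ → ℂ) : Set ℂ := {w | ∃ z, deriv f z = 0 ∧ f z = w}

/-- Finite asymptotic values of `f`. -/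
def asymptoticValues (f : ℂ → ℂ) : Set ℂ :=
  {w | ∃ γ : ℝ → ℂ, Continuous γ ∧ Tendsto (fun t => ‖γ t‖) atTop atTop ∧
    Tendsto (fun t => f (γ t)) atTop (𝓝 w)}

/-- The Eremenko–Lyubich class B. -/
def ELClass (f : ℂ → ℂ) : Prop :=
  TranscendentalEntire f ∧ Bornology.IsBounded (criticalValues f ∪ asymptoticValues f)

/-- Semihyperbolic polynomial. -/
def SemiHyperbolic (p : Polynomial ℂ) : Prop :=
  ∃ ε : ℝ, 0 < ε ∧ ∃ N : ℕ, ∀ z ∈ juliaSet (fun w => p.eval w), ∀ n : ℕ, 1 ≤ n →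
    ∀ V : Set ℂ, (∃ u ∈ (fun w => p.eval w)^[n] ⁻¹' ball z ε,
        V = connectedComponentIn ((fun w => p.eval w)^[n] ⁻¹' ball z ε) u) →
      ∀ w ∈ ball z ε,
        (∑ᶠ u ∈ {u : ℂ | u ∈ V ∧ (fun v => p.eval v)^[n] u = w},
          vanishingOrder (fun ζ => (fun v => p.eval v)^[n] ζ - w) u) ≤ N

/-- A nonconstant-derivative set splits into countably many pieces of injectivity. -/
theorem exists_injOn_partition {f : ℂ → ℂ} (hf : Differentiable ℂ f) {W : Set ℂ}
    (hW : ∀ z ∈ W, deriv f z ≠ 0) :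
    ∃ t : ℕ → Set ℂ, Pairwise (Function.onFun Disjoint t) ∧ (∀ n, MeasurableSet (t n)) ∧
      W ⊆ ⋃ n, t n ∧ ∀ n, InjOn f (W ∩ t n) := by
  classical
  let f' : ℂ → ℂ →L[ℝ] ℂ := fun z => (fderiv ℂ f z).restrictScalars ℝ
  have hf' : ∀ z, HasFDerivAt f (f' z) z := fun z =>
    (hf z).hasFDerivAt.restrictScalars ℝ
  let r : (ℂ →L[ℝ] ℂ) → NNReal := fun A => if A 1 = 0 then 1 else ‖A 1‖₊ / 2
  have hr : ∀ A, r A ≠ 0 := by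
    intro A
    simp only [r]
    split_ifs with h
    · exact one_ne_zero
    · simp [h]
  obtain ⟨t, A, ht1, ht2, ht3, ht4, ht5⟩ :=
    exists_partition_approximatesLinearOn_of_hasFDerivWithinAt f W f'
      (fun z _ => (hf' z).hasFDerivWithinAt) r hr
  refine ⟨t, ht1, ht2, ht3, fun n x hx y hy hxy => ?_⟩
  obtain ⟨w, hwW, hw⟩ := ht5 ⟨x, hx.1⟩ n
  have key := ht4 n x hx y hy
  have hA : ∀ v, A n v = v * deriv f w := by
    intro v
    rw [hw]
    simp [f', fderiv_eq_smul_deriv]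
  rw [hxy, sub_self, zero_sub, norm_neg, hA, norm_mul] at key
  have hd : A n 1 ≠ 0 := by rw [hA, one_mul]; exact hW w hwW
  simp only [r, if_neg hd] at key
  rw [hA, one_mul] at key
  have hpos : 0 < ‖deriv f w‖ := norm_pos_iff.mpr (hW w hwW)
  by_contra hne
  have : 0 < ‖x - y‖ := norm_pos_iff.mpr (sub_ne_zero.mpr hne)
  push_cast at key
  nlinarith [mul_pos this hpos]

/-- Counting a family of disjoint pieces of injectivity by the size of the fibre. -/
theorem tsum_indicator_image_le {f : ℂ → ℂ} {W : Set ℂ} {t : ℕ → Set ℂ}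
    (ht : Pairwise (Function.onFun Disjoint t)) {N : ℕ} {a : ℂ}
    (hN : ∀ s : Finset ℂ, (∀ z ∈ s, z ∈ W ∧ f z = a) → s.card ≤ N) (c : ℝ≥0∞) :
    ∑' n, (f '' (W ∩ t n)).indicator (fun _ => c) a ≤ N * c := by
  classical
  refine ENNReal.summable.tsum_le_of_sum_le fun s => ?_
  simp only [indicator_apply]
  rw [← Finset.sum_filter, Finset.sum_const, nsmul_eq_mul]
  gcongr
  set s' := s.filter fun n => a ∈ f '' (W ∩ t n)
  have h : ∀ n ∈ s', ∃ z, z ∈ W ∩ t n ∧ f z = a := fun n hn => (Finset.mem_filter.mp hn).2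
  choose! z hz using h
  have hinj : InjOn z s' := by
    intro m hm n hn hmn
    by_contra hne
    exact Set.disjoint_left.mp (ht hne) (hz m hm).1.2 (hmn ▸ (hz n hn).1.2)
  rw [← Finset.card_image_of_injOn hinj]
  apply hN
  intro w hw
  obtain ⟨n, hn, rfl⟩ := Finset.mem_image.mp hw
  exact ⟨(hz n hn).1.1, (hz n hn).2⟩

/-- Area formula with multiplicity for entire functions, as an inequality. -/
theorem lintegral_deriv_sq_le {f : ℂ → ℂ} (hf : Differentiable ℂ f) {W S : Set ℂ}
    (hWm : MeasurableSet W)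
    (hW : ∀ z ∈ W, deriv f z ≠ 0) (hWS : ∀ z ∈ W, f z ∈ S) {N : ℕ}
    (hN : ∀ a, ∀ s : Finset ℂ, (∀ z ∈ s, z ∈ W ∧ f z = a) → s.card ≤ N)
    {g : ℂ → ℝ≥0∞} (hg : Measurable g) :
    ∫⁻ z in W, ENNReal.ofReal (‖deriv f z‖ ^ 2) * g (f z) ≤ N * ∫⁻ a in S, g a := by
  obtain ⟨t, ht1, ht2, ht3, ht4⟩ := exists_injOn_partition hf hW
  have hWt : W = ⋃ n, W ∩ t n := by
    rw [← inter_iUnion, inter_eq_left.mpr ht3]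
  have hm : ∀ n, MeasurableSet (W ∩ t n) := fun n => hWm.inter (ht2 n)
  have hder : ∀ n, ∀ z ∈ W ∩ t n,
      HasFDerivWithinAt f ((fderiv ℂ f z).restrictScalars ℝ) (W ∩ t n) z := fun n z _ =>
    ((hf z).hasFDerivAt.restrictScalars ℝ).hasFDerivWithinAt
  have hdet : ∀ z, |((fderiv ℂ f z).restrictScalars ℝ).det| = ‖deriv f z‖ ^ 2 := by
    intro z
    have : (fderiv ℂ f z : ℂ →ₗ[ℂ] ℂ) = LinearMap.mulRight ℂ (deriv f z) := by
      ext; simp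
    have h2 : ((fderiv ℂ f z).restrictScalars ℝ).det
        = Algebra.norm ℝ (LinearMap.det (fderiv ℂ f z : ℂ →ₗ[ℂ] ℂ)) := by
      rw [← LinearMap.det_restrictScalars]; rfl
    rw [h2, Algebra.norm_complex_eq]
    simp [Complex.normSq_eq_norm_sq]
  have himm : ∀ n, MeasurableSet (f '' (W ∩ t n)) := fun n =>
    measurable_image_of_fderivWithin (hm n) (hder n) (ht4 n)
  have hpiece : ∀ n, ∫⁻ z in W ∩ t n, ENNReal.ofReal (‖deriv f z‖ ^ 2) * g (f z)
      = ∫⁻ a in S, (f '' (W ∩ t n)).indicator (fun _ => g a) a := by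
    intro n
    have h := lintegral_image_eq_lintegral_abs_det_fderiv_mul volume (hm n) (hder n) (ht4 n) g
    simp only [hdet] at h
    rw [← h]
    have : ∀ a, (f '' (W ∩ t n)).indicator (fun _ => g a) a
        = (f '' (W ∩ t n)).indicator g a := fun a => rfl
    simp only [this]
    rw [lintegral_indicator (himm n), Measure.restrict_restrict (himm n),
      (inter_eq_left (s := f '' (W ∩ t n)) (t := S)).mpr ?_]
    rintro _ ⟨z, hz, rfl⟩
    exact hWS z hz.1
  calc ∫⁻ z in W, ENNReal.ofReal (‖deriv f z‖ ^ 2) * g (f z)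
      = ∑' n, ∫⁻ z in W ∩ t n, ENNReal.ofReal (‖deriv f z‖ ^ 2) * g (f z) := by
        conv_lhs => rw [hWt]
        rw [lintegral_iUnion hm]
        intro m n hmn
        exact (ht1 hmn).mono inter_subset_right inter_subset_right
    _ = ∫⁻ a in S, ∑' n, (f '' (W ∩ t n)).indicator (fun _ => g a) a := by
        simp only [hpiece]
        rw [lintegral_tsum]
        intro n
        exact (hg.indicator (himm n)).aemeasurable
    _ ≤ ∫⁻ a in S, N * g a := by
        gcongr with a
        exact tsum_indicator_image_le ht1 (hN a) (g a)
    _ = N * ∫⁻ a in S, g a := lintegral_const_mul _ hg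

theorem norm_le_maxMod_of_norm_eq {f : ℂ → ℂ} (hf : Differentiable ℂ f) {r : ℝ} {z : ℂ}
    (hz : ‖z‖ = r) : ‖f z‖ ≤ maxMod f r := by
  refine le_csSup ?_ ⟨z, hz, rfl⟩
  have : IsCompact {z : ℂ | ‖z‖ = r} := by
    simpa [sphere, dist_zero_right] using isCompact_sphere (0 : ℂ) r
  exact (this.image hf.continuous.norm).bddAbove

/-- The maximum principle for the maximum modulus. -/
theorem norm_le_maxMod {f : ℂ → ℂ} (hf : Differentiable ℂ f) {r : ℝ} (hr : 0 < r) {z : ℂ}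
    (hz : ‖z‖ ≤ r) : ‖f z‖ ≤ maxMod f r := by
  refine Complex.norm_le_of_forall_mem_frontier_norm_le (U := ball 0 r) isBounded_ball
    hf.diffContOnCl (fun w hw => ?_) ?_
  · rw [frontier_ball _ hr.ne', mem_sphere_zero_iff_norm] at hw
    exact norm_le_maxMod_of_norm_eq hf hw
  · rw [closure_ball _ hr.ne', mem_closedBall_zero_iff]
    exact hz

/-- Dividing out distinct zeros of an entire function. -/
theorem exists_eq_prod_sub_mul {g : ℂ → ℂ} (hg : Differentiable ℂ g) (s : Finset ℂ)
    (hs : ∀ a ∈ s, g a = 0) :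
    ∃ h : ℂ → ℂ, Differentiable ℂ h ∧ ∀ z, g z = (∏ a ∈ s, (z - a)) * h z := by
  classical
  induction s using Finset.induction_on with
  | empty => exact ⟨g, hg, by simp⟩
  | insert a s ha ih =>
    obtain ⟨h, hh, hgh⟩ := ih fun b hb => hs b (Finset.mem_insert_of_mem hb)
    have h0 : h a = 0 := by
      have := hs a (Finset.mem_insert_self a s)
      rw [hgh a, mul_eq_zero] at this
      refine this.resolve_left ?_
      refine Finset.prod_ne_zero_iff.mpr ?_
      intro b hb hab
      exact ha (by rwa [sub_eq_zero.mp hab])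
    refine ⟨dslope h a, ?_, fun z => ?_⟩
    · rw [← differentiableOn_univ] at hh ⊢
      exact (Complex.differentiableOn_dslope univ_mem).mpr hh
    · have := sub_smul_dslope h a z
      rw [h0, sub_zero, smul_eq_mul] at this
      rw [Finset.prod_insert ha, hgh z, ← this]
      ring

/-- Distinct zeros in a disc are bounded in number by the growth. -/
theorem two_pow_card_mul_norm_le {g : ℂ → ℂ} (hg : Differentiable ℂ g) {r : ℝ} (hr : 0 < r)
    (s : Finset ℂ) (hs : ∀ a ∈ s, ‖a‖ ≤ r ∧ g a = 0) {c : ℂ} (hc : ‖c‖ ≤ r) {B : ℝ}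
    (hB : ∀ z : ℂ, ‖z‖ = 5 * r → ‖g z‖ ≤ B) : 2 ^ s.card * ‖g c‖ ≤ B := by
  obtain ⟨h, hh, hgh⟩ := exists_eq_prod_sub_mul hg s fun a ha => (hs a ha).2
  have h4 : ∀ z : ℂ, ‖z‖ = 5 * r → (4 * r) ^ s.card * ‖h z‖ ≤ B := by
    intro z hz
    refine le_trans ?_ (hB z hz)
    rw [hgh z, norm_mul, norm_prod, ← Finset.prod_const]
    gcongr with a ha
    have := norm_sub_norm_le z a
    linarith [(hs a ha).1]
  have h5 : ‖h c‖ ≤ B / (4 * r) ^ s.card := by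
    refine (norm_le_maxMod hh (r := 5 * r) (by linarith) (by linarith)).trans ?_
    refine csSup_le ?_ ?_
    · refine ⟨_, ((5 * r : ℝ) : ℂ), ?_, rfl⟩
      simp [abs_of_pos hr]
    · rintro _ ⟨z, hz, rfl⟩
      rw [le_div_iff₀ (by positivity), mul_comm]
      exact h4 z hz
  have h2 : ‖g c‖ ≤ (2 * r) ^ s.card * ‖h c‖ := by
    rw [hgh c, norm_mul, norm_prod, ← Finset.prod_const]
    gcongr with a ha
    have := norm_sub_le c a
    linarith [(hs a ha).1]
  calc 2 ^ s.card * ‖g c‖ ≤ 2 ^ s.card * ((2 * r) ^ s.card * (B / (4 * r) ^ s.card)) := by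
        gcongr
        exact h2.trans (by gcongr)
    _ = B := by
        rw [show (4 * r) = 2 * (2 * r) by ring, mul_pow 2 (2 * r)]
        field_simp

/-- Uniform bound for the number of `a`-points of `f` in a disc. -/
theorem card_fiber_le {f : ℂ → ℂ} (hf : Differentiable ℂ f) {c₁ c₂ : ℂ} {r : ℝ} (hr : 0 < r)
    (h₁ : ‖c₁‖ ≤ r) (h₂ : ‖c₂‖ ≤ r) (a : ℂ) (s : Finset ℂ)
    (hs : ∀ z ∈ s, ‖z‖ ≤ r ∧ f z = a) (hne : s.Nonempty) :
    2 ^ s.card * ‖f c₁ - f c₂‖ ≤ 4 * maxMod f (5 * r) := by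
  have ha : ‖a‖ ≤ maxMod f (5 * r) := by
    obtain ⟨z, hz⟩ := hne
    rw [← (hs z hz).2]
    exact norm_le_maxMod hf (by linarith) (by linarith [(hs z hz).1])
  have key : ∀ c : ℂ, ‖c‖ ≤ r → 2 ^ s.card * ‖f c - a‖ ≤ 2 * maxMod f (5 * r) := by
    intro c hc
    refine two_pow_card_mul_norm_le (g := fun z => f z - a) (hf.sub_const a) hr s
      (fun z hz => ⟨(hs z hz).1, by simp [(hs z hz).2]⟩) hc fun z hz => ?_
    have := norm_sub_le (f z) a
    have := norm_le_maxMod_of_norm_eq hf hz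
    linarith
  have h3 : ‖f c₁ - f c₂‖ ≤ ‖f c₁ - a‖ + ‖f c₂ - a‖ := by
    have := norm_sub_le (f c₁ - a) (f c₂ - a)
    simpa using this
  have := key c₁ h₁
  have := key c₂ h₂
  have : (2 : ℝ) ^ s.card * ‖f c₁ - f c₂‖
      ≤ 2 ^ s.card * (‖f c₁ - a‖ + ‖f c₂ - a‖) := by gcongr
  linarith

/-- The measure whose values are the logarithmic areas. -/
noncomputable def logMeasure : Measure ℂ :=
  volume.withDensity fun z : ℂ => ENNReal.ofReal ((‖z‖ ^ 2)⁻¹)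

theorem logArea_eq_logMeasure (A : Set ℂ) : logArea A = logMeasure A :=
  (withDensity_apply' _ A).symm

theorem measurableSet_Delta : MeasurableSet Delta :=
  measurableSet_le measurable_const measurable_norm

theorem one_le_logMeasure_annulus {r : ℝ} (hr : 0 < r) :
    1 ≤ logMeasure {z : ℂ | r / 2 ≤ ‖z‖ ∧ ‖z‖ ≤ r} := by
  have hset : {z : ℂ | r / 2 ≤ ‖z‖ ∧ ‖z‖ ≤ r} = closedBall 0 r \ ball 0 (r / 2) := by
    ext z
    simp [and_comm]
  have hm : MeasurableSet {z : ℂ | r / 2 ≤ ‖z‖ ∧ ‖z‖ ≤ r} := by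
    rw [hset]; exact measurableSet_closedBall.diff measurableSet_ball
  have hvol : volume {z : ℂ | r / 2 ≤ ‖z‖ ∧ ‖z‖ ≤ r}
      = ENNReal.ofReal (r ^ 2 * Real.pi - (r / 2) ^ 2 * Real.pi) := by
    rw [hset, measure_sdiff (ball_subset_closedBall.trans (closedBall_subset_closedBall
      (by linarith))) measurableSet_ball.nullMeasurableSet measure_ball_lt_top.ne,
      Complex.volume_closedBall, Complex.volume_ball, ENNReal.ofReal_sub _ (by positivity),
      ENNReal.ofReal_mul (by positivity), ENNReal.ofReal_mul (by positivity),
      ENNReal.ofReal_pow hr.le, ENNReal.ofReal_pow (by positivity), ← NNReal.coe_real_pi,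
      ENNReal.ofReal_coe_nnreal]
  have hpi := Real.pi_gt_three
  calc (1 : ℝ≥0∞) ≤ ENNReal.ofReal ((r ^ 2)⁻¹ * (r ^ 2 * Real.pi - (r / 2) ^ 2 * Real.pi)) := by
        rw [← ENNReal.ofReal_one]
        apply ENNReal.ofReal_le_ofReal
        field_simp
        nlinarith
    _ = ∫⁻ z in {z : ℂ | r / 2 ≤ ‖z‖ ∧ ‖z‖ ≤ r}, ENNReal.ofReal ((r ^ 2)⁻¹) := by
        rw [setLIntegral_const, hvol, ENNReal.ofReal_mul (by positivity)]
    _ ≤ logMeasure {z : ℂ | r / 2 ≤ ‖z‖ ∧ ‖z‖ ≤ r} := by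
        rw [← logArea_eq_logMeasure]
        refine setLIntegral_mono' hm fun z hz => ENNReal.ofReal_le_ofReal ?_
        have h0 : 0 < ‖z‖ := lt_of_lt_of_le (by positivity) hz.1
        have := hz.2
        gcongr

theorem logMeasure_bounded_lt_top (r : ℝ) : logMeasure {z ∈ Delta | ‖z‖ < r} < ⊤ := by
  have hm : MeasurableSet {z ∈ Delta | ‖z‖ < r} :=
    measurableSet_Delta.inter (measurableSet_lt measurable_norm measurable_const)
  calc logMeasure {z ∈ Delta | ‖z‖ < r} ≤ ∫⁻ z in {z ∈ Delta | ‖z‖ < r}, 1 := by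
        rw [← logArea_eq_logMeasure]
        refine setLIntegral_mono' hm fun z hz => ?_
        rw [← ENNReal.ofReal_one]
        apply ENNReal.ofReal_le_ofReal
        have : 1 ≤ ‖z‖ := hz.1
        exact inv_le_one_of_one_le₀ (one_le_pow₀ this)
    _ = volume {z ∈ Delta | ‖z‖ < r} := by simp
    _ ≤ volume (ball (0 : ℂ) r) := measure_mono fun z hz => by simpa using hz.2
    _ < ⊤ := measure_ball_lt_top

/-- A set of finite logarithmic area contains no large round annulus. -/
theorem exists_notMem_of_logMeasure_lt_top {E : Set ℂ} (hE : MeasurableSet E)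
    (hfin : logMeasure E < ⊤) :
    ∀ᶠ r : ℝ in atTop, ∃ z, z ∉ E ∧ r / 2 ≤ ‖z‖ ∧ ‖z‖ ≤ r := by
  have hT : Tendsto (fun n : ℕ => logMeasure (E ∩ {z | (n : ℝ) ≤ ‖z‖})) atTop (𝓝 0) := by
    have h := tendsto_measure_iInter_atTop (μ := logMeasure)
      (s := fun n : ℕ => E ∩ {z | (n : ℝ) ≤ ‖z‖})
      (fun n => (hE.inter (measurableSet_le measurable_const measurable_norm)).nullMeasurableSet)
      (fun m n hmn z hz => ⟨hz.1, (Nat.cast_le.mpr hmn).trans (show (n : ℝ) ≤ ‖z‖ from hz.2)⟩)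
      ⟨0, (lt_of_le_of_lt (measure_mono inter_subset_left) hfin).ne⟩
    have hempty : ⋂ n : ℕ, E ∩ {z : ℂ | (n : ℝ) ≤ ‖z‖} = ∅ := by
      rw [eq_empty_iff_forall_notMem]
      intro z hz
      obtain ⟨n, hn⟩ := exists_nat_gt ‖z‖
      exact absurd (mem_iInter.mp hz n).2 (not_le.mpr hn)
    rwa [hempty, measure_empty] at h
  obtain ⟨n, hn⟩ := (hT.eventually (gt_mem_nhds one_pos)).exists
  filter_upwards [eventually_ge_atTop (2 * (n : ℝ)), eventually_gt_atTop 0] with r hr hr0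
  by_contra! hcon
  refine absurd (one_le_logMeasure_annulus hr0) (not_le.mpr (lt_of_le_of_lt ?_ hn))
  refine measure_mono fun z hz => ⟨?_, ?_⟩
  · by_contra hzE
    exact absurd hz.2 (not_le.mpr (hcon z hzE hz.1))
  · exact le_trans (by linarith) hz.1

theorem logMeasure_Delta : logMeasure Delta = ⊤ := by
  by_contra h
  obtain ⟨r, ⟨z, hz, hz1, -⟩, hr⟩ := ((exists_notMem_of_logMeasure_lt_top measurableSet_Delta
    (lt_top_iff_ne_top.mpr h)).and (eventually_ge_atTop 2)).exists
  exact hz (show 1 ≤ ‖z‖ by linarith)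

/-- A set whose complement in `Delta` has finite logarithmic area has positive area. -/
theorem volume_pos_of_logArea_diff_lt_top {A : Set ℂ} (h : logArea (Delta \ A) < ⊤) :
    0 < volume A := by
  rw [pos_iff_ne_zero]
  intro h0
  have h1 : logMeasure A = 0 := withDensity_absolutelyContinuous _ _ h0
  have h2 : logMeasure Delta ≤ logMeasure (Delta \ A) + logMeasure A :=
    (measure_mono (by rw [sdiff_union_self]; exact subset_union_left)).trans (measure_union_le _ _)
  rw [logArea_eq_logMeasure] at h
  rw [h1, add_zero, logMeasure_Delta] at h2
  exact absurd h (not_lt.mpr h2)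

/-- The points of `Delta` where the logarithmic derivative or the function itself is small. -/
def excSet (f : ℂ → ℂ) (ρ ε : ℝ) : Set ℂ :=
  {z : ℂ | z ∈ Delta ∧
    (‖z * deriv f z / f z‖ < ‖z‖ ^ (ρ / 2 + ε) ∨ ‖f z‖ < Real.exp (‖z‖ ^ ε))}

theorem measurableSet_excSet {f : ℂ → ℂ} (hf : Differentiable ℂ f) (ρ ε : ℝ) :
    MeasurableSet (excSet f ρ ε) := by
  have h1 : Measurable f := hf.continuous.measurable
  have h2 : Measurable (deriv f) := measurable_deriv f
  refine measurableSet_Delta.inter (MeasurableSet.union ?_ ?_)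
  · exact measurableSet_lt ((measurable_id.mul h2).div h1).norm (measurable_norm.pow_const _)
  · exact measurableSet_lt h1.norm (Real.measurable_exp.comp (measurable_norm.pow_const _))

theorem le_of_notMem_excSet {f : ℂ → ℂ} {ρ ε : ℝ} {z : ℂ} (hz : z ∉ excSet f ρ ε)
    (h1 : 1 ≤ ‖z‖) :
    ‖z‖ ^ (ρ / 2 + ε) ≤ ‖z * deriv f z / f z‖ ∧ Real.exp (‖z‖ ^ ε) ≤ ‖f z‖ := by
  by_contra h
  rw [not_and_or, not_le, not_le] at h
  exact hz ⟨h1, h⟩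

theorem eventually_mul_le_exp_rpow {ε : ℝ} (hε : 0 < ε) :
    ∀ᶠ t : ℝ in atTop, 4 * t ≤ Real.exp (t ^ ε) := by
  have h1 := (isLittleO_log_rpow_atTop hε).bound (c := 1 / 2) (by norm_num)
  have h2 := (tendsto_rpow_atTop hε).eventually_ge_atTop (2 * Real.log 4)
  filter_upwards [h1, h2, eventually_gt_atTop 0] with t h1 h2 h0
  rw [Real.norm_eq_abs, Real.norm_of_nonneg (by positivity)] at h1
  have : Real.log (4 * t) ≤ t ^ ε := by
    rw [Real.log_mul (by norm_num) h0.ne']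
    linarith [le_abs_self (Real.log t)]
  rwa [Real.log_le_iff_le_exp (by positivity)] at this

theorem eventually_lt_maxMod {f : ℂ → ℂ} (hf : Differentiable ℂ f) {ρ ε : ℝ} (hε : 0 < ε)
    (hfin : logMeasure (excSet f ρ ε) < ⊤) : ∀ᶠ r : ℝ in atTop, r < maxMod f r := by
  have h2 : Tendsto (fun r : ℝ => r / 2) atTop atTop := tendsto_id.atTop_div_const two_pos
  filter_upwards [exists_notMem_of_logMeasure_lt_top (measurableSet_excSet hf ρ ε) hfin,
    h2.eventually (eventually_mul_le_exp_rpow hε), eventually_ge_atTop 2]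
    with r ⟨z, hzE, hz1, hz2⟩ h3 h4
  have h5 := (le_of_notMem_excSet hzE (by linarith)).2
  have h6 : (r / 2) ^ ε ≤ ‖z‖ ^ ε := by gcongr
  have := Real.exp_le_exp.mpr h6
  have := norm_le_maxMod hf (by linarith) hz2
  linarith

theorem eventually_maxMod_le {f : ℂ → ℂ} {ρ σ : ℝ} (hord : entireOrder f = (ρ : EReal))
    (hσ : ρ < σ) : ∀ᶠ r : ℝ in atTop, maxMod f r ≤ Real.exp (r ^ σ) := by
  have h : entireOrder f < (σ : EReal) := by rw [hord]; exact_mod_cast hσ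
  filter_upwards [eventually_lt_of_limsup_lt h, eventually_gt_atTop 1] with r hr h1
  have hr' : Real.log (Real.log (maxMod f r)) / Real.log r < σ := by exact_mod_cast hr
  rw [div_lt_iff₀ (Real.log_pos h1)] at hr'
  by_cases h0 : maxMod f r ≤ 0
  · exact h0.trans (Real.exp_pos _).le
  push Not at h0
  rw [← Real.log_le_iff_le_exp h0]
  by_cases h3 : Real.log (maxMod f r) ≤ 0
  · exact h3.trans (by positivity)
  push Not at h3
  rw [← Real.log_le_log_iff h3 (by positivity), Real.log_rpow (by positivity)]
  exact hr'.le

theorem order_nonneg {f : ℂ → ℂ} {ρ : ℝ} (hord : entireOrder f = (ρ : EReal))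
    (hM : ∀ᶠ r : ℝ in atTop, r < maxMod f r) : 0 ≤ ρ := by
  by_contra! h
  obtain ⟨r, hr1, hr2, hr3⟩ := ((eventually_maxMod_le hord h).and
    (hM.and (eventually_ge_atTop (Real.exp 1)))).exists
  rw [Real.rpow_zero] at hr1
  linarith

/-- Polynomial bound for the number of points in a fibre over a large disc. -/
theorem exists_card_fiber_le {f : ℂ → ℂ} (hf : Differentiable ℂ f) {σ : ℝ} (hσ : 0 ≤ σ)
    (hM : ∀ᶠ r : ℝ in atTop, r < maxMod f r)
    (hM' : ∀ᶠ r : ℝ in atTop, maxMod f r ≤ Real.exp (r ^ σ)) :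
    ∃ C : ℝ, 0 ≤ C ∧ ∀ᶠ x : ℝ in atTop, ∀ a, ∀ s : Finset ℂ,
      (∀ z ∈ s, ‖z‖ ≤ 2 * x ∧ f z = a) → (s.card : ℝ) ≤ C * x ^ σ := by
  obtain ⟨c, hc⟩ : ∃ c, f c ≠ f 0 := by
    by_contra! h
    obtain ⟨r, hr, hr2⟩ := (hM.and (eventually_gt_atTop (max ‖f 0‖ 0))).exists
    have h3 : maxMod f r ≤ ‖f 0‖ := by
      refine csSup_le ⟨_, (r : ℂ), ?_, rfl⟩ ?_
      · simpa using (le_max_right _ _).trans hr2.le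
      · rintro _ ⟨z, -, rfl⟩
        simp [h z]
    linarith [le_max_left ‖f 0‖ 0]
  set d := ‖f c - f 0‖
  have hd : 0 < d := norm_pos_iff.mpr (sub_ne_zero.mpr hc)
  have h2 : 0 < Real.log 2 := Real.log_pos one_lt_two
  have h10 : Tendsto (fun x : ℝ => 10 * x) atTop atTop := tendsto_id.const_mul_atTop (by norm_num)
  refine ⟨(|Real.log (4 / d)| + 10 ^ σ) / Real.log 2, by positivity, ?_⟩
  filter_upwards [h10.eventually hM', eventually_ge_atTop 1, eventually_ge_atTop ‖c‖]
    with x hx hx1 hxc a s hs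
  have hx0 : 0 < x := by linarith
  rcases s.eq_empty_or_nonempty with rfl | hne
  · simp only [Finset.card_empty, Nat.cast_zero]
    positivity
  have key := card_fiber_le hf (r := 2 * x) (by linarith) (c₁ := c) (c₂ := 0) (by linarith)
    (by simp; linarith) a s hs hne
  rw [show 5 * (2 * x) = 10 * x by ring] at key
  have key2 : (2 : ℝ) ^ s.card ≤ 4 / d * Real.exp ((10 * x) ^ σ) := by
    rw [div_mul_eq_mul_div, le_div_iff₀ hd]
    linarith
  have key3 := Real.log_le_log (by positivity) key2
  rw [Real.log_pow, Real.log_mul (by positivity) (Real.exp_pos _).ne', Real.log_exp,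
    Real.mul_rpow (by norm_num) hx0.le] at key3
  rw [div_mul_eq_mul_div, le_div_iff₀ h2, add_mul]
  have h1 : 1 ≤ x ^ σ := Real.one_le_rpow hx1 hσ
  have h4 := le_abs_self (Real.log (4 / d))
  nlinarith [abs_nonneg (Real.log (4 / d))]

/-- The contraction estimate for preimages in one annulus. -/
theorem logMeasure_annulus_preimage_le {f : ℂ → ℂ} (hf : Differentiable ℂ f) {ρ ε : ℝ}
    (hρ : 0 ≤ ρ + 2 * ε) {C x : ℝ} (hC : 0 ≤ C) (hx : 1 ≤ x)
    (hcard : ∀ a, ∀ s : Finset ℂ,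
      (∀ z ∈ s, ‖z‖ ≤ 2 * x ∧ f z = a) → (s.card : ℝ) ≤ C * x ^ (ρ + ε))
    {S : Set ℂ} (hS : MeasurableSet S) :
    logMeasure {z | z ∉ excSet f ρ ε ∧ (x ≤ ‖z‖ ∧ ‖z‖ < 2 * x) ∧ f z ∈ S}
      ≤ ENNReal.ofReal (C * x ^ (-ε)) * logMeasure S := by
  set W := {z | z ∉ excSet f ρ ε ∧ (x ≤ ‖z‖ ∧ ‖z‖ < 2 * x) ∧ f z ∈ S}
  have hx0 : 0 < x := by linarith
  have hWm : MeasurableSet W :=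
    (measurableSet_excSet hf ρ ε).compl.inter (((measurableSet_le measurable_const
      measurable_norm).inter (measurableSet_lt measurable_norm measurable_const)).inter
      (hf.continuous.measurable hS))
  have hbound : ∀ z ∈ W, x ^ (ρ / 2 + ε) ≤ ‖z * deriv f z / f z‖ := by
    intro z hz
    have h1 := (le_of_notMem_excSet hz.1 (hx.trans hz.2.1.1)).1
    refine le_trans ?_ h1
    have := hz.2.1.1
    gcongr
    linarith
  have hpos : 0 < x ^ (ρ / 2 + ε) := by positivity
  have hne : ∀ z ∈ W, deriv f z ≠ 0 ∧ f z ≠ 0 := by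
    intro z hz
    have := hpos.trans_le (hbound z hz)
    constructor
    · rintro h; simp [h] at this
    · rintro h; simp [h] at this
  have hg : Measurable fun w : ℂ => ENNReal.ofReal ((‖w‖ ^ 2)⁻¹) :=
    ((measurable_norm.pow_const 2).inv).ennreal_ofReal
  have area := lintegral_deriv_sq_le hf hWm (fun z hz => (hne z hz).1) (fun z hz => hz.2.2)
    (N := ⌊C * x ^ (ρ + ε)⌋₊) (fun a s hs => Nat.le_floor (hcard a s fun z hz =>
      ⟨(hs z hz).1.2.1.2.le, (hs z hz).2⟩)) hg
  have hpt : ∀ z ∈ W, ENNReal.ofReal ((‖z‖ ^ 2)⁻¹) ≤ ENNReal.ofReal (x ^ (-(ρ + 2 * ε))) *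
      (ENNReal.ofReal (‖deriv f z‖ ^ 2) * ENNReal.ofReal ((‖f z‖ ^ 2)⁻¹)) := by
    intro z hz
    rw [← ENNReal.ofReal_mul (by positivity), ← ENNReal.ofReal_mul (by positivity)]
    apply ENNReal.ofReal_le_ofReal
    have hz0 : 0 < ‖z‖ := hx0.trans_le hz.2.1.1
    have hfz : 0 < ‖f z‖ := norm_pos_iff.mpr (hne z hz).2
    have h1 : x ^ (ρ + 2 * ε) ≤ ‖z * deriv f z / f z‖ ^ 2 := by
      have : x ^ (ρ + 2 * ε) = (x ^ (ρ / 2 + ε)) ^ 2 := by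
        rw [← Real.rpow_natCast, ← Real.rpow_mul hx0.le]
        congr 1
        push_cast
        ring
      rw [this]
      have := hbound z hz
      gcongr
    rw [norm_div, norm_mul, div_pow, mul_pow] at h1
    rw [Real.rpow_neg hx0.le]
    have h2 : 0 < x ^ (ρ + 2 * ε) := by positivity
    calc (‖z‖ ^ 2)⁻¹ = (x ^ (ρ + 2 * ε))⁻¹ * ((‖z‖ ^ 2)⁻¹ * x ^ (ρ + 2 * ε)) := by
          field_simp
      _ ≤ (x ^ (ρ + 2 * ε))⁻¹ * ((‖z‖ ^ 2)⁻¹ * (‖z‖ ^ 2 * ‖deriv f z‖ ^ 2 / ‖f z‖ ^ 2)) := by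
          gcongr
      _ = _ := by field_simp
  calc logMeasure W
      ≤ ∫⁻ z in W, ENNReal.ofReal (x ^ (-(ρ + 2 * ε))) *
        (ENNReal.ofReal (‖deriv f z‖ ^ 2) * ENNReal.ofReal ((‖f z‖ ^ 2)⁻¹)) := by
        rw [← logArea_eq_logMeasure]
        exact setLIntegral_mono' hWm hpt
    _ = ENNReal.ofReal (x ^ (-(ρ + 2 * ε))) * ∫⁻ z in W,
        ENNReal.ofReal (‖deriv f z‖ ^ 2) * ENNReal.ofReal ((‖f z‖ ^ 2)⁻¹) := by
        rw [lintegral_const_mul' _ _ ENNReal.ofReal_ne_top]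
    _ ≤ ENNReal.ofReal (x ^ (-(ρ + 2 * ε))) *
        (ENNReal.ofReal (C * x ^ (ρ + ε)) * logMeasure S) := by
        gcongr
        refine area.trans ?_
        rw [← logArea_eq_logMeasure]
        refine mul_le_mul' ?_ le_rfl
        rw [← ENNReal.ofReal_natCast]
        exact ENNReal.ofReal_le_ofReal (Nat.floor_le (by positivity))
    _ = ENNReal.ofReal (C * x ^ (-ε)) * logMeasure S := by
        rw [← mul_assoc, ← ENNReal.ofReal_mul (by positivity)]
        congr 2
        rw [mul_left_comm, ← Real.rpow_add hx0]
        congr 2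
        ring

/-- Pulling back along `f` outside the exceptional set halves the logarithmic area. -/
theorem exists_logMeasure_preimage_le_half {f : ℂ → ℂ} (hf : Differentiable ℂ f) {ρ ε : ℝ}
    (hε : 0 < ε) (hord : entireOrder f = (ρ : EReal))
    (hM : ∀ᶠ r : ℝ in atTop, r < maxMod f r) :
    ∀ᶠ r₀ : ℝ in atTop, ∀ S, MeasurableSet S →
      logMeasure {z | z ∉ excSet f ρ ε ∧ r₀ ≤ ‖z‖ ∧ f z ∈ S} ≤ 2⁻¹ * logMeasure S := by
  have hρ := order_nonneg hord hM
  obtain ⟨C, hC, hcard⟩ := exists_card_fiber_le hf (σ := ρ + ε) (by linarith) hM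
    (eventually_maxMod_le hord (by linarith))
  obtain ⟨x₀, hx₀⟩ := eventually_atTop.mp hcard
  set q : ℝ := 2 ^ (-ε)
  have hq0 : 0 < q := by positivity
  have hq1 : q < 1 := Real.rpow_lt_one_of_one_lt_of_neg one_lt_two (by linarith)
  have hlim : Tendsto (fun r : ℝ => C * r ^ (-ε) * (1 - q)⁻¹) atTop (𝓝 0) := by
    simpa using ((tendsto_rpow_neg_atTop hε).const_mul C).mul_const (1 - q)⁻¹
  filter_upwards [hlim.eventually (gt_mem_nhds (show (0 : ℝ) < 2⁻¹ by norm_num)),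
    eventually_ge_atTop x₀, eventually_ge_atTop 1] with r hr hrx hr1 S hS
  have hr0 : 0 < r := by linarith
  have one_le_two_pow : ∀ k : ℕ, 1 ≤ (2 : ℝ) ^ k := fun k => one_le_pow₀ one_le_two
  have hsub : {z | z ∉ excSet f ρ ε ∧ r ≤ ‖z‖ ∧ f z ∈ S} ⊆ ⋃ k : ℕ,
      {z | z ∉ excSet f ρ ε ∧ (r * 2 ^ k ≤ ‖z‖ ∧ ‖z‖ < 2 * (r * 2 ^ k)) ∧ f z ∈ S} := by
    rintro z ⟨hz1, hz2, hz3⟩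
    obtain ⟨k, hk1, hk2⟩ := exists_nat_pow_near (x := ‖z‖ / r) (y := 2)
      ((one_le_div hr0).mpr hz2) one_lt_two
    rw [le_div_iff₀ hr0] at hk1
    rw [div_lt_iff₀ hr0, pow_succ] at hk2
    exact mem_iUnion.mpr ⟨k, hz1, ⟨by linarith, by linarith⟩, hz3⟩
  calc logMeasure {z | z ∉ excSet f ρ ε ∧ r ≤ ‖z‖ ∧ f z ∈ S}
      ≤ ∑' k : ℕ, logMeasure
        {z | z ∉ excSet f ρ ε ∧ (r * 2 ^ k ≤ ‖z‖ ∧ ‖z‖ < 2 * (r * 2 ^ k)) ∧ f z ∈ S} :=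
        (measure_mono hsub).trans (measure_iUnion_le _)
    _ ≤ ∑' k : ℕ, ENNReal.ofReal (C * r ^ (-ε) * q ^ k) * logMeasure S := by
        refine ENNReal.tsum_le_tsum fun k => ?_
        have hle : r ≤ r * 2 ^ k := le_mul_of_one_le_right hr0.le (one_le_two_pow k)
        refine (logMeasure_annulus_preimage_le hf (by linarith) hC (hr1.trans hle)
          (hx₀ _ (hrx.trans hle)) hS).trans_eq ?_
        congr 2
        rw [Real.mul_rpow hr0.le (by positivity), mul_assoc, ← Real.rpow_natCast 2 k,
          ← Real.rpow_mul (by norm_num), mul_comm (k : ℝ), Real.rpow_mul (by norm_num),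
          Real.rpow_natCast]
    _ = ENNReal.ofReal (C * r ^ (-ε) * (1 - q)⁻¹) * logMeasure S := by
        rw [ENNReal.tsum_mul_right, ← ENNReal.ofReal_tsum_of_nonneg (fun k => by positivity)
          ((summable_geometric_of_lt_one hq0.le hq1).mul_left _), tsum_mul_left,
          tsum_geometric_of_lt_one hq0.le hq1]
    _ ≤ 2⁻¹ * logMeasure S := by
        gcongr
        rw [← ENNReal.ofReal_ofNat 2, ← ENNReal.ofReal_inv_of_pos two_pos]
        exact ENNReal.ofReal_le_ofReal hr.le

/-- The points whose orbit enters `E` or the disc of radius `r`, by the time of entry. -/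
def entrySet (f : ℂ → ℂ) (E : Set ℂ) (r : ℝ) : ℕ → Set ℂ
  | 0 => E ∪ {z ∈ Delta | ‖z‖ < r}
  | n + 1 => {z | z ∉ E ∧ r ≤ ‖z‖ ∧ f z ∈ entrySet f E r n}

theorem measurableSet_entrySet {f : ℂ → ℂ} (hf : Differentiable ℂ f) {E : Set ℂ}
    (hE : MeasurableSet E) (r : ℝ) (n : ℕ) : MeasurableSet (entrySet f E r n) := by
  induction n with
  | zero =>
    exact hE.union (measurableSet_Delta.inter (measurableSet_lt measurable_norm measurable_const))
  | succ n ih =>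
    exact hE.compl.inter ((measurableSet_le measurable_const measurable_norm).inter
      (hf.continuous.measurable ih))

theorem logMeasure_iUnion_entrySet_lt_top {f : ℂ → ℂ} (hf : Differentiable ℂ f) {E : Set ℂ}
    (hE : MeasurableSet E) (hfin : logMeasure E < ⊤) {r : ℝ}
    (hr : ∀ S, MeasurableSet S →
      logMeasure {z | z ∉ E ∧ r ≤ ‖z‖ ∧ f z ∈ S} ≤ 2⁻¹ * logMeasure S) :
    logMeasure (⋃ n, entrySet f E r n) < ⊤ := by
  have h0 : logMeasure (entrySet f E r 0) < ⊤ :=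
    (measure_union_le _ _).trans_lt (ENNReal.add_lt_top.mpr ⟨hfin, logMeasure_bounded_lt_top r⟩)
  have hn : ∀ n, logMeasure (entrySet f E r n) ≤ 2⁻¹ ^ n * logMeasure (entrySet f E r 0) := by
    intro n
    induction n with
    | zero => simp
    | succ n ih =>
      refine (hr _ (measurableSet_entrySet hf hE r n)).trans ?_
      rw [pow_succ', mul_assoc]
      gcongr
  refine (measure_iUnion_le _).trans_lt ((ENNReal.tsum_le_tsum hn).trans_lt ?_)
  rw [ENNReal.tsum_mul_right, ENNReal.tsum_geometric]
  refine ENNReal.mul_lt_top ?_ h0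
  rw [ENNReal.one_sub_inv_two, inv_inv]
  exact ENNReal.ofNat_lt_top

/-- A point never entering `E` keeps its whole orbit in the good region. -/
theorem orbit_of_notMem_entrySet {f : ℂ → ℂ} {E : Set ℂ} {r : ℝ} (hr1 : 1 ≤ r)
    (hgrow : ∀ z, z ∉ E → r ≤ ‖z‖ → r ≤ ‖f z‖) {z : ℂ} (hz : z ∈ Delta)
    (hzE : z ∉ ⋃ n, entrySet f E r n) (n : ℕ) : f^[n] z ∉ E ∧ r ≤ ‖f^[n] z‖ := by
  have base : ∀ w ∈ Delta, w ∉ entrySet f E r 0 → w ∉ E ∧ r ≤ ‖w‖ := by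
    intro w hw h
    simp only [entrySet, mem_union, not_or] at h
    exact ⟨h.1, not_lt.mp fun h' => h.2 ⟨hw, h'⟩⟩
  suffices h : f^[n] z ∈ Delta ∧ f^[n] z ∉ ⋃ n, entrySet f E r n from
    base _ h.1 fun h' => h.2 (mem_iUnion.mpr ⟨0, h'⟩)
  induction n with
  | zero => exact ⟨hz, hzE⟩
  | succ n ih =>
    obtain ⟨h1, h2⟩ := base _ ih.1 fun h' => ih.2 (mem_iUnion.mpr ⟨0, h'⟩)
    rw [Function.iterate_succ_apply']
    refine ⟨hr1.trans (hgrow _ h1 h2), fun h => ?_⟩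
    obtain ⟨m, hm⟩ := mem_iUnion.mp h
    exact ih.2 (mem_iUnion.mpr ⟨m + 1, h1, h2, hm⟩)

/-- Comparison of the two exponential towers: an orbit growing like iterates of `exp (t ^ ε)` is
fast escaping when the maximum modulus is at most `exp (r ^ σ)`. -/
theorem mem_fastEscapingSet {f : ℂ → ℂ} {ε σ : ℝ} (hε : 0 < ε) (hεσ : ε ≤ σ)
    (hM : ∀ᶠ r : ℝ in atTop, r < maxMod f r)
    (hM' : ∀ᶠ r : ℝ in atTop, maxMod f r ≤ Real.exp (r ^ σ)) {z : ℂ}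
    (hexp : ∀ n, Real.exp (‖f^[n] z‖ ^ ε) ≤ ‖f^[n + 1] z‖)
    (hlim : Tendsto (fun n => ‖f^[n] z‖) atTop atTop) : z ∈ fastEscapingSet f := by
  have hσ : 0 < σ := hε.trans_le hεσ
  obtain ⟨R, hR⟩ := eventually_atTop.mp (hM.and (hM'.and (eventually_ge_atTop 1)))
  have hR1 : 1 ≤ R := (hR R le_rfl).2.2
  obtain ⟨C, hC1, hC⟩ : ∃ C : ℝ, 1 ≤ C ∧ σ + Real.log C ≤ ε * C := by
    have h1 := Real.isLittleO_log_id_atTop.bound (c := ε / 2) (by positivity)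
    obtain ⟨C, h1, h2, h3⟩ := (h1.and ((eventually_ge_atTop 1).and
      (eventually_ge_atTop (2 * σ / ε)))).exists
    refine ⟨C, h2, ?_⟩
    rw [id, Real.norm_eq_abs, Real.norm_of_nonneg (by linarith)] at h1
    rw [div_le_iff₀ hε] at h3
    linarith [le_abs_self (Real.log C)]
  have hC0 : 0 < C := by linarith
  obtain ⟨L, hL⟩ := (((tendsto_rpow_atTop hε).comp hlim).eventually_ge_atTop
    (C * R ^ σ)).exists
  have key : ∀ m : ℕ, R ≤ (maxMod f)^[m] R ∧
      C * ((maxMod f)^[m] R) ^ σ ≤ ‖f^[m + L] z‖ ^ ε := by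
    intro m
    induction m with
    | zero => simpa using hL
    | succ m ih =>
      obtain ⟨ih1, ih2⟩ := ih
      rw [Function.iterate_succ_apply', show m + 1 + L = m + L + 1 by ring]
      set t := (maxMod f)^[m] R
      obtain ⟨h1, h2, h3⟩ := hR t ih1
      have ht : 1 ≤ t ^ σ := Real.one_le_rpow h3 hσ.le
      refine ⟨ih1.trans h1.le, ?_⟩
      calc C * maxMod f t ^ σ ≤ C * Real.exp (t ^ σ) ^ σ := by gcongr; linarith
        _ = Real.exp (t ^ σ * σ + Real.log C) := by
          rw [← Real.exp_mul, Real.exp_add, Real.exp_log hC0, mul_comm]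
        _ ≤ Real.exp (‖f^[m + L] z‖ ^ ε * ε) := by
          apply Real.exp_le_exp.mpr
          have hl := Real.log_nonneg hC1
          nlinarith [mul_le_mul_of_nonneg_right ih2 hε.le]
        _ = Real.exp (‖f^[m + L] z‖ ^ ε) ^ ε := by rw [← Real.exp_mul]
        _ ≤ ‖f^[m + L + 1] z‖ ^ ε := by
          have := hexp (m + L)
          gcongr
  refine ⟨R, by linarith, fun r hr => (hR r hr).1, L, fun n hn => ?_⟩
  obtain ⟨h1, h2⟩ := key (n - L)
  rw [Nat.sub_add_cancel hn.le] at h2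
  set t := (maxMod f)^[n - L] R
  have ht1 : 1 ≤ t := hR1.trans h1
  have h3 : t ^ ε ≤ ‖f^[n] z‖ ^ ε := by
    refine le_trans ?_ h2
    calc t ^ ε ≤ t ^ σ := Real.rpow_le_rpow_of_exponent_le ht1 hεσ
      _ ≤ C * t ^ σ := le_mul_of_one_le_left (by positivity) hC1
  exact (Real.rpow_le_rpow_iff (by linarith) (norm_nonneg _) hε).mp h3

/-- Holomorphic logarithms on simply connected open sets. -/
theorem exists_log_of_simplyConnected {U : Set ℂ} (hU : IsOpen U) [SimplyConnectedSpace U]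
    {f : ℂ → ℂ} (hf : DifferentiableOn ℂ f U) (h0 : ∀ z ∈ U, f z ≠ 0) :
    ∃ h : ℂ → ℂ, DifferentiableOn ℂ h U ∧ ∀ z ∈ U, Complex.exp (h z) = f z := by
  classical
  have : LocallyPathConnectedSpace U := hU.locallyPathConnectedSpace
  obtain ⟨⟨a, ha⟩⟩ : Nonempty U := inferInstance
  let F : C(U, ℂ) := ⟨fun z => f z, continuousOn_iff_continuous_domRestrict.mp hf.continuousOn⟩
  obtain ⟨G, ⟨-, hG⟩, -⟩ := Complex.isCoveringMapOn_exp.existsUnique_continuousMap_lifts F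
    (a₀ := ⟨a, ha⟩) (e₀ := Complex.log (f a)) (Complex.exp_log (h0 a ha)) (fun z => h0 z z.2)
  let h : ℂ → ℂ := fun z => if hz : z ∈ U then G ⟨z, hz⟩ else 0
  have hexp : ∀ z ∈ U, Complex.exp (h z) = f z := by
    intro z hz
    simp only [h, dif_pos hz]
    exact congr_fun hG ⟨z, hz⟩
  have hcont : ContinuousOn h U := by
    rw [continuousOn_iff_continuous_domRestrict]
    convert G.continuous using 1
    ext z
    simp [h, domRestrict]
  refine ⟨h, fun z hz => DifferentiableAt.differentiableWithinAt ?_, hexp⟩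
  have hca : ContinuousAt h z := hcont.continuousAt (hU.mem_nhds hz)
  have hfa : DifferentiableAt ℂ f z := hf.differentiableAt (hU.mem_nhds hz)
  have heq : h =ᶠ[𝓝 z] fun y => h z + Complex.log (f y / f z) := by
    have hball : ∀ᶠ y in 𝓝 z, dist (h y) (h z) < Real.pi :=
      Metric.tendsto_nhds.mp hca _ Real.pi_pos
    filter_upwards [hball, hU.mem_nhds hz] with y hy hyU
    rw [← hexp y hyU, ← hexp z hz, ← Complex.exp_sub]
    have him : |(h y - h z).im| < Real.pi :=
      (Complex.abs_im_le_norm _).trans_lt (by rwa [← dist_eq_norm])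
    rw [abs_lt] at him
    rw [Complex.log_exp him.1 him.2.le]
    ring
  refine DifferentiableAt.congr_of_eventuallyEq ?_ heq
  refine (DifferentiableAt.clog (hfa.div_const _) ?_).const_add _
  rw [div_self (h0 z hz)]
  exact Complex.one_mem_slitPlane

theorem exists_log_on_ball {f : ℂ → ℂ} {c : ℂ} {R : ℝ} (hR : 0 < R)
    (hf : DifferentiableOn ℂ f (ball c R)) (h0 : ∀ z ∈ ball c R, f z ≠ 0) :
    ∃ h : ℂ → ℂ, DifferentiableOn ℂ h (ball c R) ∧ ∀ z ∈ ball c R, Complex.exp (h z) = f z := by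
  have : ContractibleSpace (ball c R) :=
    (convex_ball c R).contractibleSpace ⟨c, mem_ball_self hR⟩
  exact exists_log_of_simplyConnected isOpen_ball hf h0

/-- Harnack's inequality for `log ‖F‖` with `F` holomorphic of modulus at least one. -/
theorem log_norm_le_three_mul {F : ℂ → ℂ} {c p : ℂ} {R : ℝ}
    (hF : DifferentiableOn ℂ F (ball c R)) (h1 : ∀ z ∈ ball c R, 1 ≤ ‖F z‖)
    (hp : p ∈ ball c (R / 2)) : Real.log ‖F p‖ ≤ 3 * Real.log ‖F c‖ := by
  have hR : 0 < R := by linarith [pos_of_mem_ball hp]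
  obtain ⟨h, hh, hexp⟩ := exists_log_on_ball hR hF fun z hz h0 => by
    have := h1 z hz
    rw [h0, norm_zero] at this
    linarith
  have hre : ∀ z ∈ ball c R, (h z).re = Real.log ‖F z‖ := by
    intro z hz
    rw [← hexp z hz, Complex.norm_exp, Real.log_exp]
  set G : ℂ → ℂ := fun x => -(h (c + x) - (h c).im * Complex.I) with hG
  have hmaps : ∀ x ∈ ball (0 : ℂ) R, c + x ∈ ball c R := fun x hx => by
    simpa [mem_ball, dist_eq_norm] using hx
  have hGre : ∀ x ∈ ball (0 : ℂ) R, (G x).re = -Real.log ‖F (c + x)‖ := by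
    intro x hx
    simp [hG, hre _ (hmaps x hx)]
  have hGd : DifferentiableOn ℂ G (ball 0 R) :=
    ((hh.comp ((differentiable_id.const_add c).differentiableOn) hmaps).sub_const _).neg
  have hp' : p - c ∈ ball (0 : ℂ) R := by
    rw [mem_ball_zero_iff, ← dist_eq_norm]
    linarith [mem_ball.mp hp]
  have hpn : ‖p - c‖ < R / 2 := by rw [← dist_eq_norm]; exact hp
  have hc : c ∈ ball c R := mem_ball_self hR
  have hG0 : ‖G 0‖ = Real.log ‖F c‖ := by
    have : G 0 = ((-(h c).re : ℝ) : ℂ) := by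
      apply Complex.ext <;> simp [hG]
    rw [this, Complex.norm_real, Real.norm_eq_abs, abs_neg, hre c hc,
      abs_of_nonneg (Real.log_nonneg (h1 c hc))]
  refine le_of_forall_pos_le_add fun η hη => ?_
  have hBC := Complex.borelCaratheodory (M := η / 2) (half_pos hη) hGd (fun x hx => ?_) hR hp'
  · have h2 := (Complex.abs_re_le_norm (G (p - c))).trans hBC
    rw [hGre _ hp', abs_neg, add_sub_cancel, hG0] at h2
    have hlog : 0 ≤ Real.log ‖F c‖ := Real.log_nonneg (h1 c hc)
    have hden : 0 < R - ‖p - c‖ := by linarith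
    have e1 : 2 * (η / 2) * ‖p - c‖ / (R - ‖p - c‖) ≤ η := by
      rw [div_le_iff₀ hden]; nlinarith
    have e2 : Real.log ‖F c‖ * (R + ‖p - c‖) / (R - ‖p - c‖) ≤ 3 * Real.log ‖F c‖ := by
      rw [div_le_iff₀ hden]; nlinarith
    linarith [le_abs_self (Real.log ‖F p‖)]
  · change (G x).re ≤ η / 2
    rw [hGre x hx]
    linarith [Real.log_nonneg (h1 _ (hmaps x hx))]

/-- A weak form of Bloch's theorem: a holomorphic function not taking two values at distance
`2πi` has bounded derivative at the centre of the disc. -/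
theorem norm_deriv_mul_le_of_ne_add {g : ℂ → ℂ} {c : ℂ} {d : ℝ} (hd : 0 < d)
    (hg : DifferentiableOn ℂ g (ball c (2 * d)))
    (hne : ∀ p ∈ ball c (2 * d), ∀ q ∈ ball c (2 * d), g p ≠ g q + 2 * Real.pi * Complex.I) :
    d * ‖deriv g c‖ ≤ 96 * Real.pi := by
  have hsub : closedBall c d ⊆ ball c (2 * d) := closedBall_subset_ball (by linarith)
  have hg' : DifferentiableOn ℂ (deriv g) (ball c (2 * d)) := hg.deriv isOpen_ball
  have hcont : ContinuousOn (fun x => (d - dist x c) * ‖deriv g x‖) (closedBall c d) :=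
    (by fun_prop : Continuous fun x => d - dist x c).continuousOn.mul
      (hg'.continuousOn.mono hsub).norm
  obtain ⟨x₀, hx₀, hmax⟩ := (isCompact_closedBall c d).exists_isMaxOn
    ⟨c, mem_closedBall_self hd.le⟩ hcont
  have hmaxc : d * ‖deriv g c‖ ≤ (d - dist x₀ c) * ‖deriv g x₀‖ := by
    simpa using hmax (mem_closedBall_self hd.le)
  rcases (norm_nonneg (deriv g c)).eq_or_lt with h0 | hpos
  · rw [← h0, mul_zero]
    positivity
  set t := (d - dist x₀ c) / 2 with ht
  set a := ‖deriv g x₀‖ with ha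
  have hprod : 0 < (d - dist x₀ c) * a := (mul_pos hd hpos).trans_le hmaxc
  have ha0 : 0 < a := pos_of_mul_pos_right hprod (by linarith [mem_closedBall.mp hx₀])
  have ht0 : 0 < t := by
    have := pos_of_mul_pos_left hprod ha0.le
    positivity
  have hball : ball x₀ t ⊆ closedBall c d := fun x hx => by
    have := dist_triangle x x₀ c
    have := mem_ball.mp hx
    rw [mem_closedBall]
    linarith
  have hder : ∀ x ∈ ball x₀ t, ‖deriv g x‖ ≤ 2 * a := by
    intro x hx
    have h1 : (d - dist x c) * ‖deriv g x‖ ≤ (d - dist x₀ c) * a := hmax (hball hx)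
    have h2 : t ≤ d - dist x c := by
      have := dist_triangle x x₀ c
      have := mem_ball.mp hx
      linarith
    have h3 : t * ‖deriv g x‖ ≤ t * (2 * a) := by
      calc t * ‖deriv g x‖ ≤ (d - dist x c) * ‖deriv g x‖ := by gcongr
        _ ≤ t * (2 * a) := by rw [ht]; linarith
    exact le_of_mul_le_mul_left h3 ht0
  have hlip : ∀ x ∈ ball x₀ t, ‖deriv g x - deriv g x₀‖ ≤ 3 * a / t * dist x x₀ := by
    intro x hx
    rw [← dist_eq_norm]
    refine Complex.dist_le_div_mul_dist_of_mapsTo_ball (hg'.mono (hball.trans hsub))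
      (fun y hy => ?_) hx
    rw [mem_closedBall, dist_eq_norm]
    linarith [norm_sub_le (deriv g y) (deriv g x₀), hder y hy]
  have h6 : closedBall x₀ (t / 6) ⊆ ball x₀ t := closedBall_subset_ball (by linarith)
  have happrox : ∀ x ∈ closedBall x₀ (t / 6),
      ‖g x - g x₀ - (x - x₀) * deriv g x₀‖ ≤ a / 2 * ‖x - x₀‖ := by
    intro x hx
    have hd2 : ∀ y ∈ closedBall x₀ (t / 6),
        HasDerivWithinAt (fun y => g y - y * deriv g x₀) (deriv g y - deriv g x₀)
          (closedBall x₀ (t / 6)) y := by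
      intro y hy
      have h1 : HasDerivAt g (deriv g y) y :=
        (hg.differentiableAt (isOpen_ball.mem_nhds (hsub (hball (h6 hy))))).hasDerivAt
      have h2 := (h1.fun_sub ((hasDerivAt_id y).mul_const (deriv g x₀))).hasDerivWithinAt
        (s := closedBall x₀ (t / 6))
      rw [one_mul] at h2
      exact h2
    have := (convex_closedBall x₀ (t / 6)).norm_image_sub_le_of_norm_hasDerivWithin_le hd2
      (C := a / 2) (fun y hy => ?_) (mem_closedBall_self (by positivity)) hx
    · rw [show g x - g x₀ - (x - x₀) * deriv g x₀
          = g x - x * deriv g x₀ - (g x₀ - x₀ * deriv g x₀) by ring]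
      exact this
    · refine (hlip y (h6 hy)).trans ?_
      calc 3 * a / t * dist y x₀ ≤ 3 * a / t * (t / 6) := by
            gcongr; exact mem_closedBall.mp hy
        _ = a / 2 := by field_simp; norm_num
  have hsphere : ∀ x ∈ closedBall x₀ (t / 6), a / 2 * ‖x - x₀‖ ≤ ‖g x - g x₀‖ := by
    intro x hx
    have h1 := happrox x hx
    have h2 := norm_sub_norm_le ((x - x₀) * deriv g x₀) (g x - g x₀)
    rw [norm_sub_rev ((x - x₀) * deriv g x₀), norm_mul, ← ha] at h2
    linarith
  have himage : ball (g x₀) (a * t / 12 / 2) ⊆ g '' closedBall x₀ (t / 6) := by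
    have h7 : closedBall x₀ (t / 6) ⊆ ball c (2 * d) := h6.trans (hball.trans hsub)
    refine DiffContOnCl.ball_subset_image_closedBall ?_ (by positivity) (fun x hx => ?_) ?_
    · refine DifferentiableOn.diffContOnCl ?_
      rw [closure_ball _ (by positivity)]
      exact hg.mono h7
    · refine le_trans (le_of_eq ?_) (hsphere x (sphere_subset_closedBall hx))
      rw [mem_sphere_iff_norm.mp hx]
      ring
    · have h8 : ∀ᶠ x in 𝓝[≠] x₀, g x ≠ g x₀ := by
        filter_upwards [self_mem_nhdsWithin,
          nhdsWithin_le_nhds (closedBall_mem_nhds x₀ (by positivity : 0 < t / 6))] with x hx hx2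
        intro heq
        have h9 := hsphere x hx2
        have h10 : 0 < ‖x - x₀‖ := norm_pos_iff.mpr (sub_ne_zero.mpr hx)
        rw [heq, sub_self, norm_zero] at h9
        nlinarith [mul_pos ha0 h10]
      exact h8.frequently.filter_mono nhdsWithin_le_nhds
  have hat : a * t ≤ 48 * Real.pi := by
    by_contra! hlt
    obtain ⟨p, hp, hpe⟩ := himage (show g x₀ + 2 * Real.pi * Complex.I ∈ _ by
      rw [mem_ball, dist_eq_norm, add_sub_cancel_left]
      simp [abs_of_pos Real.pi_pos]
      linarith)
    exact hne p (hsub (hball (h6 hp))) x₀ (hsub hx₀) hpe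
  rw [ht] at hat
  linarith

/-- The square of the chordal distance to the origin, up to normalization. -/
noncomputable def sphHeight : Option ℂ → ℝ
  | none => 1
  | some z => ‖z‖ ^ 2 / (1 + ‖z‖ ^ 2)

theorem abs_sphHeight_sub_le (z : ℂ) (w : Option ℂ) :
    |sphHeight (some z) - sphHeight w| ≤ chordalDist (some z) w := by
  have hz : 0 < 1 + ‖z‖ ^ 2 := by positivity
  have hsz : 1 ≤ Real.sqrt (1 + ‖z‖ ^ 2) := Real.one_le_sqrt.mpr (by nlinarith [sq_nonneg ‖z‖])
  have hsz2 := Real.sq_sqrt hz.le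
  set A := Real.sqrt (1 + ‖z‖ ^ 2)
  cases w with
  | none =>
    simp only [sphHeight, chordalDist]
    rw [show ‖z‖ ^ 2 / (1 + ‖z‖ ^ 2) - 1 = -(1 / (1 + ‖z‖ ^ 2)) by field_simp; ring, abs_neg,
      abs_of_pos (by positivity), div_le_div_iff₀ hz (by positivity)]
    nlinarith
  | some w =>
    have hw : 0 < 1 + ‖w‖ ^ 2 := by positivity
    have hsw : 1 ≤ Real.sqrt (1 + ‖w‖ ^ 2) := Real.one_le_sqrt.mpr (by nlinarith [sq_nonneg ‖w‖])
    have hsw2 := Real.sq_sqrt hw.le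
    simp only [sphHeight, chordalDist]
    set B := Real.sqrt (1 + ‖w‖ ^ 2)
    have h1 : ‖z‖ + ‖w‖ ≤ A * B := by
      refine abs_le_of_sq_le_sq' ?_ (by positivity) |>.2
      rw [mul_pow, hsz2, hsw2]
      nlinarith [sq_nonneg (‖z‖ * ‖w‖ - 1)]
    have h2 : ‖z‖ ^ 2 / (1 + ‖z‖ ^ 2) - ‖w‖ ^ 2 / (1 + ‖w‖ ^ 2)
        = (‖z‖ - ‖w‖) * (‖z‖ + ‖w‖) / (A ^ 2 * B ^ 2) := by
      rw [hsz2, hsw2]; field_simp; ring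
    have hAB : 0 < A * B := by positivity
    rw [h2, abs_div, abs_mul, abs_of_nonneg (by positivity : 0 ≤ ‖z‖ + ‖w‖),
      abs_of_pos (by positivity : 0 < A ^ 2 * B ^ 2),
      div_le_div_iff₀ (by positivity) hAB]
    have h3 := abs_norm_sub_norm_le z w
    have h4 : |‖z‖ - ‖w‖| * (‖z‖ + ‖w‖) ≤ ‖z - w‖ * (A * B) := by gcongr
    have h5 : 0 ≤ ‖z - w‖ * (A * B) * (A * B) := by positivity
    calc |‖z‖ - ‖w‖| * (‖z‖ + ‖w‖) * (A * B) ≤ ‖z - w‖ * (A * B) * (A * B) := by gcongr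
      _ ≤ 2 * (‖z - w‖ * (A * B) * (A * B)) := by linarith
      _ = _ := by ring

theorem continuous_sphHeight_some : Continuous fun z : ℂ => sphHeight (some z) := by
  simp only [sphHeight]
  exact (continuous_norm.pow 2).div (by fun_prop) fun z => by positivity

/-- Near a Fatou point, iterates which are large somewhere are not small anywhere. -/
theorem exists_ball_of_mem_fatouSet {f : ℂ → ℂ} (hf : Continuous f) {z : ℂ}
    (hz : z ∈ fatouSet f) : ∃ s > 0, ∃ N : ℕ, ∀ n ≥ N, ∀ q ∈ ball z s, ∀ q' ∈ ball z s,
      2 ≤ ‖f^[n] q‖ → 1 ≤ ‖f^[n] q'‖ := by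
  obtain ⟨U, hU, hnorm⟩ := hz
  obtain ⟨s₀, hs₀, hsU⟩ := Metric.nhds_basis_closedBall.mem_iff.mp hU
  by_contra! hcon
  have hfreq : ∀ m : ℕ, ∃ᶠ n in atTop, ∃ q ∈ ball z (1 / ((m : ℝ) + 1)),
      ∃ q' ∈ ball z (1 / ((m : ℝ) + 1)), 2 ≤ ‖f^[n] q‖ ∧ ‖f^[n] q'‖ < 1 := fun m =>
    frequently_atTop.mpr fun N => hcon _ Nat.one_div_pos_of_nat N
  obtain ⟨φ, hφ, hφP⟩ := extraction_forall_of_frequently hfreq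
  choose q hq q' hq' h2 h1 using hφP
  obtain ⟨ψ, hψ, g, hg⟩ := hnorm φ hφ
  have hunif : TendstoUniformlyOn (fun n x => sphHeight (some (f^[φ (ψ n)] x)))
      (fun x => sphHeight (g x)) atTop (closedBall z s₀) := by
    rw [Metric.tendstoUniformlyOn_iff]
    intro η hη
    filter_upwards [hg _ hsU (isCompact_closedBall z s₀) η hη] with n hn x hx
    rw [dist_comm]
    exact (abs_sphHeight_sub_le _ _).trans_lt (hn x hx)
  have hcont : ContinuousOn (fun x => sphHeight (g x)) (closedBall z s₀) :=
    hunif.continuousOn (Eventually.of_forall fun n =>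
      (continuous_sphHeight_some.comp (hf.iterate _)).continuousOn).frequently
  have hca := hcont z (mem_closedBall_self hs₀.le)
  have hlim : ∀ p : ℕ → ℂ, (∀ m : ℕ, p m ∈ ball z (1 / ((m : ℝ) + 1))) →
      Tendsto (fun n => sphHeight (some (f^[φ (ψ n)] (p (ψ n))))) atTop
        (𝓝 (sphHeight (g z))) := by
    intro p hp
    have hpz : Tendsto (fun n => p (ψ n)) atTop (𝓝 z) := by
      rw [tendsto_iff_dist_tendsto_zero]
      refine squeeze_zero (fun _ => dist_nonneg) (fun n => (mem_ball.mp (hp (ψ n))).le)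
        (tendsto_one_div_add_atTop_nhds_zero_nat.comp hψ.tendsto_atTop)
    have hpz' : Tendsto (fun n => p (ψ n)) atTop (𝓝[closedBall z s₀] z) :=
      tendsto_nhdsWithin_iff.mpr ⟨hpz, hpz.eventually (closedBall_mem_nhds z hs₀)⟩
    exact tendsto_comp_of_locally_uniform_limit_within (f := fun x => sphHeight (g x))
      (F := fun n x => sphHeight (some (f^[φ (ψ n)] x))) hca hpz' fun u hu =>
        ⟨closedBall z s₀, self_mem_nhdsWithin, hunif u hu⟩
  have hge : 4 / 5 ≤ sphHeight (g z) := by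
    refine ge_of_tendsto' (hlim q hq) fun n => ?_
    have := h2 (ψ n)
    simp only [sphHeight]
    rw [div_le_div_iff₀ (by norm_num) (by positivity)]
    nlinarith
  have hle : sphHeight (g z) ≤ 1 / 2 := by
    refine le_of_tendsto' (hlim q' hq') fun n => ?_
    have := h1 (ψ n)
    have h0 := norm_nonneg (f^[φ (ψ n)] (q' (ψ n)))
    simp only [sphHeight]
    rw [div_le_div_iff₀ (by positivity) (by norm_num)]
    nlinarith
  linarith

theorem isOpen_fatouSet (f : ℂ → ℂ) : IsOpen (fatouSet f) := by
  rw [isOpen_iff_mem_nhds]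
  rintro z ⟨U, hU, hnorm⟩
  filter_upwards [eventually_mem_nhds_iff.mpr hU] with w hw
  exact ⟨U, hw, hnorm⟩

theorem image_mem_nhds_of_lt_maxMod {f : ℂ → ℂ} (hf : Differentiable ℂ f)
    (hM : ∀ᶠ r in atTop, r < maxMod f r) {z : ℂ} {B : Set ℂ} (hB : B ∈ 𝓝 z) :
    f '' B ∈ 𝓝 (f z) := by
  rcases (hf.analyticAt z).eventually_constant_or_nhds_le_map_nhds with hc | hmap
  · have heq : f = fun _ => f z :=
      AnalyticOnNhd.eq_of_eventuallyEq (fun w _ => hf.analyticAt w)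
        (fun w _ => analyticAt_const) hc
    obtain ⟨r, hr, hrz⟩ := (hM.and (eventually_ge_atTop ‖f z‖)).exists
    have hle : maxMod f r ≤ ‖f z‖ := by
      refine Real.sSup_le ?_ (norm_nonneg _)
      rintro _ ⟨w, -, rfl⟩
      exact (congrArg norm (congrFun heq w)).le
    linarith
  · exact hmap (image_mem_map hB)

theorem apply_mem_fatouSet {f : ℂ → ℂ} (hf : Differentiable ℂ f)
    (hM : ∀ᶠ r in atTop, r < maxMod f r) {z : ℂ} (hz : z ∈ fatouSet f) : f z ∈ fatouSet f := by
  obtain ⟨U, hU, hnorm⟩ := hz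
  obtain ⟨s, hs, hsU⟩ := Metric.nhds_basis_closedBall.mem_iff.mp hU
  refine ⟨f '' closedBall z s, image_mem_nhds_of_lt_maxMod hf hM (closedBall_mem_nhds z hs),
    fun φ hφ => ?_⟩
  obtain ⟨ψ, hψ, g, hg⟩ := hnorm (fun n => φ n + 1) (fun _ _ h => Nat.succ_lt_succ (hφ h))
  have hex : ∀ v : ℂ, ∃ u, v ∈ f '' closedBall z s → u ∈ closedBall z s ∧ f u = v := by
    intro v
    by_cases hv : v ∈ f '' closedBall z s
    · obtain ⟨u, hu⟩ := hv
      exact ⟨u, fun _ => hu⟩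
    · exact ⟨0, fun h => absurd h hv⟩
  choose σ hσ using hex
  refine ⟨ψ, hψ, g ∘ σ, fun K hK _ η hη => ?_⟩
  filter_upwards [hg _ hsU (isCompact_closedBall z s) η hη] with n hn v hv
  obtain ⟨hu, hv'⟩ := hσ v (hK hv)
  have := hn _ hu
  simp only [Function.iterate_succ_apply, hv'] at this
  exact this

theorem iterate_mem_fatouSet {f : ℂ → ℂ} (hf : Differentiable ℂ f)
    (hM : ∀ᶠ r in atTop, r < maxMod f r) {z : ℂ} (hz : z ∈ fatouSet f) (n : ℕ) :
    f^[n] z ∈ fatouSet f :=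
  (show MapsTo f (fatouSet f) (fatouSet f) from
    fun _ => apply_mem_fatouSet hf hM).iterate n hz

/-- Points near a Fatou point escape at comparable rates. -/
theorem exists_ball_log_norm_iterate_le {f : ℂ → ℂ} (hf : Differentiable ℂ f) {z : ℂ}
    (hz : z ∈ fatouSet f) : ∃ s > 0, ∀ p ∈ ball z s, ∀ p' ∈ ball z s,
      Tendsto (fun n => ‖f^[n] p‖) atTop atTop → ∀ᶠ n in atTop,
        Real.log ‖f^[n] p'‖ ≤ 3 * Real.log ‖f^[n] p‖ ∧
          Real.log ‖f^[n] p‖ ≤ 3 * Real.log ‖f^[n] p'‖ := by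
  obtain ⟨s, hs, N, hN⟩ := exists_ball_of_mem_fatouSet hf.continuous hz
  have hsub : ∀ p ∈ ball z (s / 5), ball p (4 * (s / 5)) ⊆ ball z s := fun p hp =>
    ball_subset_ball' (by linarith [mem_ball.mp hp])
  refine ⟨s / 5, by positivity, fun p hp p' hp' hlim => ?_⟩
  have hdist : dist p p' < 4 * (s / 5) / 2 := by
    linarith [dist_triangle_right p p' z, mem_ball.mp hp, mem_ball.mp hp']
  filter_upwards [hlim.eventually_ge_atTop 2, eventually_ge_atTop N] with n hn hnN
  have h1 : ∀ q ∈ ball z s, 1 ≤ ‖f^[n] q‖ := fun q hq =>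
    hN n hnN p (ball_subset_ball (by linarith) hp) q hq hn
  have hdiff : Differentiable ℂ f^[n] := hf.iterate n
  exact ⟨log_norm_le_three_mul hdiff.differentiableOn (fun q hq => h1 q (hsub p hp hq))
      (by rwa [mem_ball, dist_comm]),
    log_norm_le_three_mul hdiff.differentiableOn (fun q hq => h1 q (hsub p' hp' hq))
      (by rwa [mem_ball])⟩

theorem fatouSet_ne_univ {f : ℂ → ℂ} (hf : Differentiable ℂ f) {ε : ℝ} (hε : 0 < ε) {w : ℂ}
    (hexp : ∀ n, Real.exp (‖f^[n] w‖ ^ ε) ≤ ‖f^[n + 1] w‖)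
    (hlim : Tendsto (fun n => ‖f^[n] w‖) atTop atTop) : fatouSet f ≠ univ := by
  intro huniv
  let T : Set ℂ := {q | Tendsto (fun n => ‖f^[n] q‖) atTop atTop ∧
    ∃ C : ℝ, 0 < C ∧ ∀ᶠ n in atTop, Real.log ‖f^[n] q‖ ≤ C * Real.log ‖f^[n] w‖}
  have hloc : ∀ z, ∃ s > 0, ∀ p ∈ ball z s, ∀ p' ∈ ball z s, p ∈ T → p' ∈ T := by
    intro z
    obtain ⟨s, hs, hcomp⟩ := exists_ball_log_norm_iterate_le hf (huniv ▸ mem_univ z)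
    refine ⟨s, hs, fun p hp p' hp' ⟨hpl, C, hC, hpC⟩ => ?_⟩
    have hev := hcomp p hp p' hp' hpl
    refine ⟨?_, 3 * C, by positivity, ?_⟩
    · refine tendsto_atTop_mono' _ ?_
        ((Real.tendsto_log_atTop.comp hpl).atTop_div_const (by norm_num : (0 : ℝ) < 3))
      filter_upwards [hev] with n hn
      have := Real.log_le_self (norm_nonneg (f^[n] p'))
      simp only [Function.comp_apply]
      linarith [hn.2]
    · filter_upwards [hev, hpC] with n hn hn'
      linarith [hn.1]
  have hclopen : IsClopen T := by
    refine ⟨⟨isOpen_iff_mem_nhds.mpr fun z hz => ?_⟩, isOpen_iff_mem_nhds.mpr fun z hz => ?_⟩ <;>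
    obtain ⟨s, hs, hT⟩ := hloc z
    · filter_upwards [ball_mem_nhds z hs] with p hp hpT
      exact hz (hT p hp z (mem_ball_self hs) hpT)
    · filter_upwards [ball_mem_nhds z hs] with p hp
      exact hT z (mem_ball_self hs) p hp hz
  have hwT : w ∈ T := ⟨hlim, 1, one_pos, Eventually.of_forall fun n => by rw [one_mul]⟩
  have hfw : f w ∈ T := hclopen.eq_univ ⟨w, hwT⟩ ▸ mem_univ _
  obtain ⟨-, C, hC, hev⟩ := hfw
  have hlittle := hlim.eventually ((isLittleO_log_rpow_atTop hε).bound
    (by positivity : 0 < 1 / (2 * C)))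
  obtain ⟨n, h1, h2, h3⟩ := (hev.and (hlittle.and (hlim.eventually_ge_atTop 1))).exists
  have hpos : 0 < ‖f^[n] w‖ ^ ε := Real.rpow_pos_of_pos (by linarith) ε
  rw [Real.norm_of_nonneg (Real.log_nonneg h3), Real.norm_of_nonneg hpos.le] at h2
  have h4 : ‖f^[n] w‖ ^ ε ≤ Real.log ‖f^[n + 1] w‖ :=
    (Real.le_log_iff_exp_le ((Real.exp_pos _).trans_le (hexp n))).mpr (hexp n)
  rw [Function.iterate_succ_apply] at h4
  have h5 : C * Real.log ‖f^[n] w‖ ≤ C * (1 / (2 * C) * ‖f^[n] w‖ ^ ε) := by gcongr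
  have h6 : C * (1 / (2 * C) * ‖f^[n] w‖ ^ ε) = ‖f^[n] w‖ ^ ε / 2 := by field_simp
  linarith

theorem mul_deriv_iterate_div_eq_prod {f : ℂ → ℂ} (hf : Differentiable ℂ f) {z : ℂ}
    (h0 : ∀ n, f^[n] z ≠ 0) (n : ℕ) :
    z * deriv f^[n] z / f^[n] z
      = ∏ k ∈ Finset.range n, f^[k] z * deriv f (f^[k] z) / f (f^[k] z) := by
  induction n with
  | zero => simp [deriv_id, div_self (show z ≠ 0 from h0 0)]
  | succ n ih =>
    have hd : deriv f^[n + 1] z = deriv f (f^[n] z) * deriv f^[n] z := by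
      rw [Function.iterate_succ', deriv_comp z (hf _) ((hf.iterate n) z)]
    rw [Finset.prod_range_succ, ← ih, hd, Function.iterate_succ_apply' f n z]
    have h1 := h0 n
    have h2 := h0 (n + 1)
    rw [Function.iterate_succ_apply'] at h2
    field_simp

theorem mem_juliaSet_of_growth {f : ℂ → ℂ} (hf : Differentiable ℂ f)
    (hM : ∀ᶠ r in atTop, r < maxMod f r) (hmult : NoMultiplyConnectedFatouComponent f)
    (hne : fatouSet f ≠ univ) {z : ℂ} {δ : ℝ} (hδ : 0 < δ) (h1 : ∀ n, 1 ≤ ‖f^[n] z‖)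
    (hderiv : ∀ n, ‖f^[n] z‖ ^ δ ≤ ‖f^[n] z * deriv f (f^[n] z) / f (f^[n] z)‖)
    (hlim : Tendsto (fun n => ‖f^[n] z‖) atTop atTop) : z ∈ juliaSet f := by
  intro hz
  obtain ⟨ζ, hζ⟩ := (ne_univ_iff_exists_notMem _).mp hne
  obtain ⟨s, hs, hsF⟩ := Metric.isOpen_iff.mp (isOpen_fatouSet f) z hz
  have hbound : ∀ n, s / 2 * ‖deriv f^[n] z / (f^[n] z - ζ)‖ ≤ 96 * Real.pi := by
    intro n
    have hnF := iterate_mem_fatouSet hf hM hz n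
    set U := connectedComponentIn (fatouSet f) (f^[n] z) with hUdef
    have hUo : IsOpen U := (isOpen_fatouSet f).connectedComponentIn
    have hUF : U ⊆ fatouSet f := connectedComponentIn_subset _ _
    have := hmult _ hnF
    obtain ⟨h, hh, hexp⟩ := exists_log_of_simplyConnected (f := fun v => v - ζ) hUo
      (by fun_prop) fun v hv heq => hζ (by rw [← sub_eq_zero.mp heq]; exact hUF hv)
    have hmaps : MapsTo f^[n] (ball z s) U := by
      rw [mapsTo_iff_image_subset]
      refine ((convex_ball z s).isPreconnected.image _
        (hf.continuous.iterate n).continuousOn).subset_connectedComponentIn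
        (mem_image_of_mem _ (mem_ball_self hs)) ?_
      rintro _ ⟨p, hp, rfl⟩
      exact iterate_mem_fatouSet hf hM (hsF hp) n
    have hball : ball z (2 * (s / 2)) = ball z s := by rw [mul_div_cancel₀ s two_ne_zero]
    have hdn : Differentiable ℂ f^[n] := hf.iterate n
    have key := norm_deriv_mul_le_of_ne_add (g := h ∘ f^[n]) (c := z) (half_pos hs)
      (by rw [hball]; exact hh.comp hdn.differentiableOn hmaps) (by
        rw [hball]
        intro p hp q hq heq
        have he := congrArg Complex.exp heq
        simp only [Function.comp_apply] at he
        rw [Complex.exp_periodic, hexp _ (hmaps hp), hexp _ (hmaps hq)] at he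
        simp only [Function.comp_apply, sub_left_injective he] at heq
        exact Complex.two_pi_I_ne_zero (left_eq_add.mp heq))
    have hzU : f^[n] z ∈ U := hmaps (mem_ball_self hs)
    have hhd : DifferentiableAt ℂ h (f^[n] z) := hh.differentiableAt (hUo.mem_nhds hzU)
    have hdh : deriv h (f^[n] z) * (f^[n] z - ζ) = 1 := by
      have e1 : (fun v => Complex.exp (h v)) =ᶠ[𝓝 (f^[n] z)] fun v => v - ζ :=
        (hUo.eventually_mem hzU).mono fun v hv => hexp v hv
      have e2 := e1.deriv_eq
      rw [deriv_cexp hhd, hexp _ hzU] at e2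
      rw [mul_comm, e2]
      simp
    have hne0 : f^[n] z - ζ ≠ 0 := right_ne_zero_of_mul_eq_one hdh
    rwa [deriv_comp z hhd (hdn z), eq_div_of_mul_eq hne0 hdh, one_div_mul_eq_div] at key
  have hz1 : 1 ≤ ‖z‖ := h1 0
  have hgrow : ∀ n, ‖f^[n] z‖ ^ δ * ‖f^[n + 1] z‖ ≤ ‖z‖ * ‖deriv f^[n + 1] z‖ := by
    intro n
    have hpos : 0 < ‖f^[n + 1] z‖ := one_pos.trans_le (h1 _)
    rw [← le_div_iff₀ hpos, ← norm_mul, ← norm_div,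
      mul_deriv_iterate_div_eq_prod hf fun k => norm_pos_iff.mp (one_pos.trans_le (h1 k)),
      Finset.prod_range_succ, norm_mul, norm_prod]
    refine (hderiv n).trans (le_mul_of_one_le_left (norm_nonneg _) ?_)
    exact Finset.prod_induction _ (1 ≤ ·) (fun _ _ => one_le_mul_of_one_le_of_one_le) le_rfl fun k _ => (Real.one_le_rpow (h1 k) hδ.le).trans (hderiv k)
  have hlimδ := (tendsto_rpow_atTop hδ).comp hlim
  obtain ⟨n, hn1, hn2⟩ := ((hlimδ.eventually_gt_atTop (2 * (‖z‖ * (96 * Real.pi / (s / 2))))).and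
    ((tendsto_add_atTop_iff_nat 1).mpr hlim |>.eventually_ge_atTop ‖ζ‖)).exists
  have hb := hbound (n + 1)
  have hg := hgrow n
  have hpos : 0 < ‖f^[n + 1] z‖ := one_pos.trans_le (h1 _)
  have hsub : ‖f^[n + 1] z - ζ‖ ≤ 2 * ‖f^[n + 1] z‖ := by
    linarith [norm_sub_le (f^[n + 1] z) ζ]
  have hsubpos : 0 < ‖f^[n + 1] z - ζ‖ := by
    rw [norm_pos_iff, sub_ne_zero]
    rintro rfl
    exact hζ (iterate_mem_fatouSet hf hM hz _)
  rw [mul_comm, ← le_div_iff₀ (by positivity), norm_div, div_le_iff₀ hsubpos] at hb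
  set K := 96 * Real.pi / (s / 2) with hK
  have hK0 : 0 ≤ K := by positivity
  have hcontra : ‖f^[n] z‖ ^ δ * ‖f^[n + 1] z‖ ≤ 2 * (‖z‖ * K) * ‖f^[n + 1] z‖ := by
    calc ‖f^[n] z‖ ^ δ * ‖f^[n + 1] z‖ ≤ ‖z‖ * ‖deriv f^[n + 1] z‖ := hg
      _ ≤ ‖z‖ * (K * ‖f^[n + 1] z - ζ‖) := by gcongr
      _ ≤ ‖z‖ * (K * (2 * ‖f^[n + 1] z‖)) := by gcongr
      _ = _ := by ring
  exact absurd (le_of_mul_le_mul_right hcontra hpos) (not_le.mpr hn1)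

theorem fast_escaping_and_julia_positive_measure
    (f : ℂ → ℂ) (hf : Differentiable ℂ f) (ρ ε : ℝ)
    (hord : entireOrder f = (ρ : EReal)) (hε : 0 < ε)
    (hyp : logArea {z : ℂ | z ∈ Delta ∧
        (‖z * deriv f z / f z‖ < ‖z‖ ^ (ρ / 2 + ε) ∨ ‖f z‖ < Real.exp (‖z‖ ^ ε))} < ⊤) :
    logArea (Delta \ fastEscapingSet f) < ⊤ ∧ 0 < volume (fastEscapingSet f) ∧
      (NoMultiplyConnectedFatouComponent f →
        logArea (Delta \ (fastEscapingSet f ∩ juliaSet f)) < ⊤ ∧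
          0 < volume (fastEscapingSet f ∩ juliaSet f)) := by
  have hE := measurableSet_excSet hf ρ ε
  have hfin : logMeasure (excSet f ρ ε) < ⊤ := logArea_eq_logMeasure (excSet f ρ ε) ▸ hyp
  have hM := eventually_lt_maxMod hf hε hfin
  have hρ := order_nonneg hord hM
  have hδ : 0 < ρ / 2 + ε := by linarith
  obtain ⟨r₁, hr₁⟩ := eventually_atTop.mp (eventually_mul_le_exp_rpow hε)
  obtain ⟨r, hhalf, hr1, hrr₁⟩ := ((exists_logMeasure_preimage_le_half hf hε hord hM).and
    ((eventually_ge_atTop 1).and (eventually_ge_atTop r₁))).exists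
  have hstep : ∀ z, z ∉ excSet f ρ ε → r ≤ ‖z‖ → 4 * ‖z‖ ≤ ‖f z‖ := fun z hz hrz =>
    (hr₁ _ (hrr₁.trans hrz)).trans (le_of_notMem_excSet hz (hr1.trans hrz)).2
  have hgood : ∀ z ∈ Delta \ ⋃ n, entrySet f (excSet f ρ ε) r n, z ∈ fastEscapingSet f ∧
      (NoMultiplyConnectedFatouComponent f → z ∈ juliaSet f) := by
    rintro z ⟨hzD, hzE⟩
    have horb := orbit_of_notMem_entrySet hr1
      (fun w hw hrw => by linarith [hstep w hw hrw]) hzD hzE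
    have h1 : ∀ n, 1 ≤ ‖f^[n] z‖ := fun n => hr1.trans (horb n).2
    have hexp : ∀ n, Real.exp (‖f^[n] z‖ ^ ε) ≤ ‖f^[n + 1] z‖ := fun n => by
      rw [Function.iterate_succ_apply']
      exact (le_of_notMem_excSet (horb n).1 (h1 n)).2
    have hpow : ∀ n, (4 : ℝ) ^ n ≤ ‖f^[n] z‖ := by
      intro n
      induction n with
      | zero => simpa using h1 0
      | succ n ih =>
        have := hstep _ (horb n).1 (horb n).2
        rw [Function.iterate_succ_apply', pow_succ]
        linarith
    have hlim : Tendsto (fun n => ‖f^[n] z‖) atTop atTop :=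
      tendsto_atTop_mono hpow (tendsto_pow_atTop_atTop_of_one_lt (by norm_num))
    refine ⟨mem_fastEscapingSet (σ := ρ + ε) hε (by linarith) hM
      (eventually_maxMod_le hord (by linarith)) hexp hlim, fun hmult => ?_⟩
    exact mem_juliaSet_of_growth hf hM hmult (fatouSet_ne_univ hf hε hexp hlim) hδ h1
      (fun n => (le_of_notMem_excSet (horb n).1 (h1 n)).1) hlim
  have hsmall : ∀ A : Set ℂ, (∀ z ∈ Delta \ ⋃ n, entrySet f (excSet f ρ ε) r n, z ∈ A) →
      logArea (Delta \ A) < ⊤ := by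
    intro A hA
    rw [logArea_eq_logMeasure]
    refine (measure_mono fun z hz => ?_).trans_lt
      (logMeasure_iUnion_entrySet_lt_top hf hE hfin hhalf)
    by_contra hzE
    exact hz.2 (hA z ⟨hz.1, hzE⟩)
  have hA := hsmall _ fun z hz => (hgood z hz).1
  refine ⟨hA, volume_pos_of_logArea_diff_lt_top hA, fun hmult => ?_⟩
  have hAJ := hsmall (fastEscapingSet f ∩ juliaSet f) fun z hz =>
    ⟨(hgood z hz).1, (hgood z hz).2 hmult⟩
  exact ⟨hAJ, volume_pos_of_logArea_diff_lt_top hAJ⟩
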